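/- Let p be a prime, let G be a finite p-group, and let N be a normal subgroup of G of index p^n. Then (p/(p²+1))^n · m(G) ≤ m(N) ≤ ((p²+1)/p)^n · m(G). -/

import Mathlib

open CategoryTheory Module

/-- Isomorphism-equivalence on irreducible `d`-dimensional complex representations of `G`. -/
def irrSetoid (G : Type) [Group G] (d : ℕ) :
    Setoid {ρ : FDRep ℂ G // Simple ρ ∧ finrank ℂ ρ = d} where
  r x y := Nonempty (x.1 ≅ y.1)
  iseqv := ⟨fun _ => ⟨Iso.refl _⟩, fun ⟨e⟩ => ⟨e.symm⟩, fun ⟨e⟩ ⟨f⟩ => ⟨e.trans f⟩⟩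

/-- The number of irreducible complex characters of `G` of degree `d`, i.e. the number of
isomorphism classes of irreducible `d`-dimensional complex representations of `G`. -/
noncomputable def multOfDegree (G : Type) [Group G] (d : ℕ) : ℕ :=
  Nat.card (Quotient (irrSetoid G d))

/-- `m(G)`: the maximal multiplicity of the irreducible complex character degrees of `G`. -/
noncomputable def maxMult (G : Type) [Group G] : ℕ :=
  sSup (Set.range (multOfDegree G))

set_option linter.unusedSectionVars false

noncomputable def ip {G : Type} [Group G] [Fintype G] (f h : G → ℂ) : ℂ :=
  (Nat.card G : ℂ)⁻¹ * ∑ g : G, f g * h g⁻¹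

/-- characters of finite-dimensional representations -/
def chr (G : Type) [Group G] : Set (G → ℂ) :=
  {χ | ∃ (V : Type) (_ : AddCommGroup V) (_ : Module ℂ V) (_ : FiniteDimensional ℂ V)
    (ρ : Representation ℂ G V), ρ.character = χ}

/-- irreducible characters -/
def irr (G : Type) [Group G] : Set (G → ℂ) :=
  {χ | ∃ (V : Type) (_ : AddCommGroup V) (_ : Module ℂ V) (_ : FiniteDimensional ℂ V)
    (ρ : Representation ℂ G V), ρ.IsIrreducible ∧ ρ.character = χ}

section basics

variable {G : Type} [Group G]

lemma irr_chr {χ : G → ℂ} (h : χ ∈ irr G) : χ ∈ chr G := by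
  obtain ⟨V, i1, i2, i3, ρ, -, h⟩ := h
  exact ⟨V, i1, i2, i3, ρ, h⟩

lemma chr_deg {χ : G → ℂ} (h : χ ∈ chr G) : ∃ d : ℕ, χ 1 = d := by
  obtain ⟨V, i1, i2, i3, ρ, rfl⟩ := h
  exact ⟨_, ρ.char_one⟩

lemma irr_deg {χ : G → ℂ} (h : χ ∈ irr G) : χ 1 ≠ 0 := by
  obtain ⟨V, i1, i2, i3, ρ, hi, rfl⟩ := h
  rw [ρ.char_one]
  have : Nontrivial V := by
    by_contra hV
    rw [not_nontrivial_iff_subsingleton] at hV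
    have := hi.1
    obtain ⟨a, b, hab⟩ := this
    apply hab
    apply SetLike.ext
    intro x
    have : x = 0 := Subsingleton.elim _ _
    subst this
    exact ⟨fun _ => b.toSubmodule.zero_mem, fun _ => a.toSubmodule.zero_mem⟩
  have := Module.finrank_pos (R := ℂ) (M := V)
  exact_mod_cast this.ne'

lemma chr_add {χ ψ : G → ℂ} (h : χ ∈ chr G) (h' : ψ ∈ chr G) : χ + ψ ∈ chr G := by
  obtain ⟨V, i1, i2, i3, ρ, rfl⟩ := h
  obtain ⟨W, j1, j2, j3, σ, rfl⟩ := h'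
  refine ⟨V × W, inferInstance, inferInstance, inferInstance, ρ.prod σ, ?_⟩
  ext g
  exact LinearMap.trace_prodMap' (ρ g) (σ g)

lemma chr_closure_aux (n : ℕ) [Finite G] : ∀ (V : Type) (_ : AddCommGroup V) (_ : Module ℂ V)
    (_ : FiniteDimensional ℂ V) (ρ : Representation ℂ G V), finrank ℂ V = n →
    ρ.character ∈ AddSubmonoid.closure (irr G) := by
  induction n using Nat.strong_induction_on with
  | _ n ih =>
  intro V i1 i2 i3 ρ hn
  by_cases hirr : ρ.IsIrreducible
  · exact AddSubmonoid.subset_closure ⟨V, i1, i2, i3, ρ, hirr, rfl⟩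
  rcases subsingleton_or_nontrivial V with hV | hV
  · convert (AddSubmonoid.closure (irr G)).zero_mem
    ext g
    have : ρ g = 0 := Subsingleton.elim _ _
    simp [Representation.character, this]
  have hex : ∃ W : Subrepresentation ρ, W ≠ ⊥ ∧ W ≠ ⊤ := by
    by_contra hcon
    push Not at hcon
    apply hirr
    have : Nontrivial (Subrepresentation ρ) := by
      refine ⟨⊥, ⊤, fun h => ?_⟩
      have h2 : (⊥ : Submodule ℂ V) = ⊤ := congrArg Subrepresentation.toSubmodule h
      exact bot_ne_top h2
    exact ⟨fun W => or_iff_not_imp_left.2 (hcon W)⟩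
  obtain ⟨W, hW0, hW1⟩ := hex
  obtain ⟨W', hc⟩ := exists_isCompl W
  have hc' : IsCompl W.toSubmodule W'.toSubmodule := by
    constructor
    · rw [disjoint_iff, ← Subrepresentation.toSubmodule_inf, disjoint_iff.1 hc.1]; rfl
    · rw [codisjoint_iff, ← Subrepresentation.toSubmodule_sup, codisjoint_iff.1 hc.2]; rfl
  have hchar : ρ.character = W.toRepresentation.character + W'.toRepresentation.character := by
    ext g
    have h1 := LinearMap.trace_prodMap' (W.toRepresentation g) (W'.toRepresentation g)
    rw [← LinearMap.trace_conj' _ (Submodule.prodEquivOfIsCompl _ _ hc')] at h1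
    simp only [Representation.character, Pi.add_apply]
    rw [← h1]
    congr 1
    ext v
    obtain ⟨⟨a, b⟩, rfl⟩ := (Submodule.prodEquivOfIsCompl _ _ hc').surjective v
    simp [LinearEquiv.conj_apply, Submodule.coe_prodEquivOfIsCompl']
    rfl
  have hd := Submodule.finrank_add_eq_of_isCompl hc'
  have hp1 : finrank ℂ W.toSubmodule ≠ 0 := by
    intro h
    rw [Submodule.finrank_eq_zero] at h
    exact hW0 (Subrepresentation.toSubmodule_injective h)
  have hp2 : finrank ℂ W.toSubmodule ≠ n := by
    intro h
    exact hW1 (Subrepresentation.toSubmodule_injective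
      (Submodule.eq_top_of_finrank_eq (h.trans hn.symm)))
  rw [hchar]
  exact AddSubmonoid.add_mem _ (ih _ (by omega) _ _ _ inferInstance _ rfl)
    (ih _ (by omega) _ _ _ inferInstance _ rfl)

lemma chr_closure [Finite G] {χ : G → ℂ} (h : χ ∈ chr G) : χ ∈ AddSubmonoid.closure (irr G) := by
  obtain ⟨V, i1, i2, i3, ρ, rfl⟩ := h
  exact chr_closure_aux _ V i1 i2 i3 ρ rfl

variable [Fintype G]

lemma ip_comm (f h : G → ℂ) : ip f h = ip h f := by
  unfold ip
  congr 1
  apply Fintype.sum_equiv (Equiv.inv G)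
  intro g
  simp [mul_comm]

lemma ip_add_left (f f' h : G → ℂ) : ip (f + f') h = ip f h + ip f' h := by
  simp [ip, add_mul, Finset.sum_add_distrib, mul_add]

lemma ip_smul_left (c : ℂ) (f h : G → ℂ) : ip (c • f) h = c * ip f h := by
  simp [ip, Finset.mul_sum]
  congr 1; ext; ring

noncomputable def ipL (h : G → ℂ) : (G → ℂ) →ₗ[ℂ] ℂ where
  toFun f := ip f h
  map_add' f f' := ip_add_left f f' h
  map_smul' c f := ip_smul_left c f h

lemma ip_sum_left {ι : Type*} (s : Finset ι) (c : ι → ℂ) (f : ι → G → ℂ) (h : G → ℂ) :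
    ip (∑ i ∈ s, c i • f i) h = ∑ i ∈ s, c i * ip (f i) h := by
  have := map_sum (ipL h) (fun i => c i • f i) s
  simp only [map_smul] at this
  exact this

noncomputable instance : Invertible (Nat.card G : ℂ) := invertibleOfNonzero (by simp)

open Classical in
lemma ip_irr {χ ψ : G → ℂ} (h : χ ∈ irr G) (h' : ψ ∈ irr G) :
    ip χ ψ = if χ = ψ then 1 else 0 := by
  obtain ⟨V, i1, i2, i3, ρ, hi, rfl⟩ := h
  obtain ⟨W, j1, j2, j3, σ, hj, rfl⟩ := h'
  have h1 := Representation.char_orthonormal ρ σ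
  have h2 := Representation.char_orthonormal ρ ρ
  change ip _ _ = _ at h1
  change ip _ _ = _ at h2
  rw [if_pos ⟨Representation.Equiv.refl ρ⟩] at h2
  by_cases he : Nonempty (σ.Equiv ρ)
  · rw [h1, if_pos he, if_pos]
    obtain ⟨e⟩ := he
    exact (Representation.char_iso e).symm
  · rw [if_neg he] at h1
    split_ifs with h3
    · rw [← h3, h2]
    · simpa using h1

lemma ip_irr_self {χ : G → ℂ} (h : χ ∈ irr G) : ip χ χ = 1 := by
  classical
  simp [ip_irr h h]

lemma chr_nat {χ ψ : G → ℂ} (h : χ ∈ chr G) (h' : ψ ∈ chr G) : ∃ n : ℕ, ip χ ψ = n := by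
  obtain ⟨V, i1, i2, i3, ρ, rfl⟩ := h
  obtain ⟨W, j1, j2, j3, σ, rfl⟩ := h'
  exact ⟨_, Representation.card_inv_mul_sum_char_mul_char_eq_finrank σ ρ⟩

lemma irr_finite : (irr G).Finite := by
  classical
  have : LinearIndependent ℂ (fun χ : irr G => (χ : G → ℂ)) := by
    rw [linearIndependent_iff']
    intro s c hs i hi
    have := ip_sum_left s c (fun χ : irr G => (χ : G → ℂ)) i
    rw [hs] at this
    simp only [ip_irr (Subtype.prop _) (Subtype.prop i), ← Subtype.ext_iff] at this
    simp [hi] at this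
    rw [← this]
    simp [ip]
  exact Set.finite_coe_iff.1 this.finite
end basics
section basics2

variable {G : Type} [Group G] [Fintype G]

noncomputable def irrF (G : Type) [Group G] [Fintype G] : Finset (G → ℂ) :=
  (irr_finite (G := G)).toFinset

lemma mem_irrF {χ : G → ℂ} : χ ∈ irrF G ↔ χ ∈ irr G := by
  simp [irrF]

lemma chr_expand {ψ : G → ℂ} (h : ψ ∈ chr G) : ψ = ∑ θ ∈ irrF G, ip ψ θ • θ := by
  classical
  replace h := chr_closure h
  induction h using AddSubmonoid.closure_induction with
  | mem x hx =>
    symm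
    rw [Finset.sum_eq_single x]
    · rw [ip_irr_self hx, one_smul]
    · intro b hb hbx
      rw [ip_irr hx (mem_irrF.1 hb), if_neg hbx.symm, zero_smul]
    · intro hx'
      exact absurd (mem_irrF.2 hx) hx'
  | zero => simp [ip]
  | add x y _ _ hx hy =>
    simp only [ip_add_left, add_smul, Finset.sum_add_distrib]
    rw [← hx, ← hy]

lemma ip_expand {ψ : G → ℂ} (h : ψ ∈ chr G) (φ : G → ℂ) :
    ip ψ φ = ∑ θ ∈ irrF G, ip ψ θ * ip φ θ := by
  conv_lhs => rw [chr_expand h, ip_sum_left]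
  simp only [ip_comm φ]

lemma chr_norm_one {ψ : G → ℂ} (h : ψ ∈ chr G) (h1 : ip ψ ψ = 1) : ψ ∈ irr G := by
  classical
  have hn : ∀ θ ∈ irrF G, ∃ n : ℕ, ip ψ θ = n := fun θ hθ =>
    chr_nat h (irr_chr (mem_irrF.1 hθ))
  choose! n hn using hn
  have hs : ∑ θ ∈ irrF G, n θ * n θ = 1 := by
    rw [ip_expand h, Finset.sum_congr rfl (fun θ hθ => by rw [hn θ hθ])] at h1
    exact_mod_cast h1
  obtain ⟨θ, hθ, hne⟩ := Finset.exists_ne_zero_of_sum_ne_zero (hs.trans_ne one_ne_zero)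
  have hsplit := Finset.add_sum_erase _ (fun θ => n θ * n θ) hθ
  rw [hs] at hsplit
  have hz : ∑ x ∈ (irrF G).erase θ, n x * n x = 0 := by omega
  have ht1 : n θ * n θ = 1 := by omega
  have ht : n θ = 1 := Nat.eq_one_of_mul_eq_one_left ht1
  rw [Finset.sum_eq_zero_iff] at hz
  rw [chr_expand h, Finset.sum_eq_single θ]
  · rw [hn θ hθ, ht]; simpa using mem_irrF.1 hθ
  · intro b hb hbθ
    have := hz b (Finset.mem_erase.2 ⟨hbθ, hb⟩)
    rw [hn b hb]
    simp at this
    simp [this]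
  · intro h; exact absurd hθ h

lemma simple_irr (V : FDRep ℂ G) (h : Simple V) : V.character ∈ irr G := by
  refine chr_norm_one ⟨V, inferInstance, inferInstance, inferInstance, V.ρ, rfl⟩ ?_
  rw [FDRep.simple_iff_char_is_norm_one] at h
  rw [ip, h]
  simp

lemma irr_simple {χ : G → ℂ} (h : χ ∈ irr G) : ∃ V : FDRep ℂ G, Simple V ∧ V.character = χ := by
  have h1 := ip_irr_self h
  obtain ⟨V, i1, i2, i3, ρ, hi, rfl⟩ := h
  refine ⟨FDRep.of ρ, ?_, rfl⟩
  rw [FDRep.simple_iff_char_is_norm_one]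
  unfold ip at h1
  rw [inv_mul_eq_one₀ (by simp)] at h1
  exact h1.symm

lemma char_inj (V W : FDRep ℂ G) (hV : Simple V) (hW : Simple W)
    (h : V.character = W.character) : Nonempty (V ≅ W) := by
  classical
  have h1 := FDRep.char_orthonormal V W
  have h2 := FDRep.char_orthonormal V V
  rw [if_pos ⟨Iso.refl V⟩] at h2
  rw [← h, h2] at h1
  by_contra hc
  rw [if_neg hc] at h1
  simp at h1

def irrD (G : Type) [Group G] (d : ℕ) : Set (G → ℂ) := {χ | χ ∈ irr G ∧ χ 1 = d}

lemma mult_eq (d : ℕ) : multOfDegree G d = (irrD G d).ncard := by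
  unfold multOfDegree
  rw [← Nat.card_coe_set_eq]
  let f : Quotient (irrSetoid G d) → irrD G d := Quotient.lift
    (fun x => (⟨x.1.character, simple_irr _ x.2.1, by rw [FDRep.char_one, x.2.2]⟩ : irrD G d))
    (fun x y ⟨e⟩ => Subtype.ext (FDRep.char_iso e))
  apply Nat.card_congr (Equiv.ofBijective f ⟨?_, ?_⟩)
  · intro x y
    induction x using Quotient.inductionOn with | _ x =>
    induction y using Quotient.inductionOn with | _ y =>
    intro h
    exact Quotient.sound (char_inj _ _ x.2.1 y.2.1 (congrArg Subtype.val h))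
  · rintro ⟨χ, h, hd⟩
    obtain ⟨V, hV, rfl⟩ := irr_simple h
    refine ⟨Quotient.mk _ ⟨V, hV, ?_⟩, rfl⟩
    rw [FDRep.char_one] at hd
    exact_mod_cast hd

lemma irrD_finite (d : ℕ) : (irrD G d).Finite := irr_finite.subset fun _ h => h.1

lemma mult_bdd : BddAbove (Set.range (multOfDegree G)) := by
  refine ⟨(irr G).ncard, ?_⟩
  rintro _ ⟨d, rfl⟩
  rw [mult_eq]
  exact Set.ncard_le_ncard (fun _ h => h.1) irr_finite

lemma mult_le (d : ℕ) : (irrD G d).ncard ≤ maxMult G := by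
  rw [← mult_eq]
  exact le_csSup mult_bdd ⟨d, rfl⟩

lemma maxMult_le (c : ℕ) (k : ℕ) (h : ∀ d, k * (irrD G d).ncard ≤ c) : k * maxMult G ≤ c := by
  obtain ⟨d, hd⟩ := Nat.sSup_mem (Set.range_nonempty (multOfDegree G)) mult_bdd
  unfold maxMult
  rw [← hd, mult_eq]
  exact h d

lemma comp_chr {H : Type} [Group H] (f : H →* G) {χ : G → ℂ} (h : χ ∈ chr G) :
    (fun x => χ (f x)) ∈ chr H := by
  obtain ⟨V, i1, i2, i3, ρ, rfl⟩ := h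
  exact ⟨V, i1, i2, i3, ρ.comp f, rfl⟩

lemma comp_equiv_irr {H : Type} [Group H] [Fintype H] (f : H ≃* G) {χ : G → ℂ}
    (h : χ ∈ irr G) : (fun x => χ (f x)) ∈ irr H := by
  apply chr_norm_one (comp_chr f.toMonoidHom (irr_chr h))
  rw [← ip_irr_self h]
  unfold ip
  rw [Nat.card_congr f.toEquiv]
  congr 1
  apply Fintype.sum_equiv f.toEquiv
  intro x
  simp

lemma maxMult_le_of_equiv {H : Type} [Group H] [Fintype H] (f : H ≃* G) :
    maxMult G ≤ maxMult H := by
  have := maxMult_le (G := G) (maxMult H) 1 ?_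
  · simpa using this
  intro d
  rw [one_mul]
  refine le_trans ?_ (mult_le d)
  apply Set.ncard_le_ncard_of_injOn (fun χ x => χ (f x)) _ _ (irrD_finite d)
  · rintro χ ⟨h, hd⟩
    exact ⟨comp_equiv_irr f h, by simpa using hd⟩
  · intro χ _ ψ _ h
    ext x
    simpa using congrFun h (f.symm x)

lemma maxMult_equiv {H : Type} [Group H] [Fintype H] (f : H ≃* G) :
    maxMult G = maxMult H :=
  le_antisymm (maxMult_le_of_equiv f) (maxMult_le_of_equiv f.symm)

open Classical in
lemma reg_chr : (fun g : G => if g = 1 then (Nat.card G : ℂ) else 0) ∈ chr G := by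
  let ρ : Representation ℂ G (G → ℂ) :=
    { toFun := fun g => LinearMap.funLeft ℂ ℂ (fun x => x * g)
      map_one' := by ext; simp [LinearMap.funLeft]
      map_mul' := fun a b => by ext; simp [LinearMap.funLeft, mul_assoc] }
  refine ⟨G → ℂ, inferInstance, inferInstance, inferInstance, ρ, ?_⟩
  ext g
  unfold Representation.character
  rw [LinearMap.trace_eq_matrix_trace ℂ (Pi.basisFun ℂ G)]
  have h1 : ∀ x : G, LinearMap.toMatrix (Pi.basisFun ℂ G) (Pi.basisFun ℂ G) (ρ g) x x =
      if g = 1 then 1 else 0 := by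
    intro x
    simp [ρ, LinearMap.funLeft, Pi.single_apply]
  simp only [Matrix.trace, Matrix.diag, h1]
  split_ifs with h <;> simp

lemma exists_over {N : Subgroup G} [Fintype N] {θ : N → ℂ} (h : θ ∈ irr N) :
    ∃ χ ∈ irr G, ip (fun n : N => χ n) θ ≠ 0 := by
  classical
  by_contra! hc
  have h1 := chr_expand (reg_chr (G := G))
  set r : G → ℂ := fun g : G => if g = 1 then (Nat.card G : ℂ) else 0 with hr
  have h2 : (fun n : N => r n) = ∑ χ ∈ irrF G, ip r χ • (fun n : N => χ n) := by
    ext n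
    have := congrFun h1 n
    simpa using this
  have h3 : ip (fun n : N => r n) θ = 0 := by
    rw [h2, ip_sum_left]
    exact Finset.sum_eq_zero fun χ hχ => by rw [hc χ (mem_irrF.1 hχ), mul_zero]
  simp [ip, hr] at h3
  exact irr_deg h h3

end basics2
section clifford

variable {G : Type} [Group G] [Fintype G] {N : Subgroup G} [Fintype N]

def res (N : Subgroup G) (χ : G → ℂ) : N → ℂ := fun n => χ n

lemma res_chr {χ : G → ℂ} (h : χ ∈ chr G) : res N χ ∈ chr N := comp_chr N.subtype h

lemma exists_intertwine {V W : Type} [AddCommGroup V] [Module ℂ V] [FiniteDimensional ℂ V]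
    [AddCommGroup W] [Module ℂ W] [FiniteDimensional ℂ W] (ρ : Representation ℂ G V)
    (σ : Representation ℂ G W) :
    ip σ.character ρ.character ≠ 0 ↔ ∃ f : V →ₗ[ℂ] W, f ≠ 0 ∧ ∀ g v, f (ρ g v) = σ g (f v) := by
  have h : ip σ.character ρ.character = _ :=
    Representation.card_inv_mul_sum_char_mul_char_eq_finrank ρ σ
  rw [h, Nat.cast_ne_zero]
  constructor
  · intro h0
    have : 0 < finrank ℂ (ρ.IntertwiningMap σ) := by omega
    obtain ⟨f, hf⟩ := Module.finrank_pos_iff_exists_ne_zero.1 this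
    refine ⟨f.toLinearMap, fun h => hf ?_, fun g v => ?_⟩
    · ext v
      exact LinearMap.congr_fun h v
    · exact f.isIntertwining _ _ g v
  · rintro ⟨f, hf, hfg⟩
    have : (⟨f, fun g => LinearMap.ext (hfg g)⟩ : ρ.IntertwiningMap σ) ≠ 0 := by
      intro h
      apply hf
      exact congrArg Representation.IntertwiningMap.toLinearMap h
    have := Module.finrank_pos_iff_exists_ne_zero (R := ℂ).2 ⟨_, this⟩
    omega

lemma clifford (hN : N.Normal) {χ : G → ℂ} {θ θ' : N → ℂ} (hχ : χ ∈ irr G) (hθ : θ ∈ irr N)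
    (hθ' : θ' ∈ irr N) (h : ip (res N χ) θ ≠ 0) (h' : ip (res N χ) θ' ≠ 0) :
    ip (res N χ) θ = ip (res N χ) θ' ∧ θ 1 = θ' 1 := by
  classical
  -- conjugate character
  have key : ∃ g : G, (fun n : N => θ (MulAut.conjNormal g n)) = θ' := by
    have hc : ∀ g : G, (fun n : N => θ (MulAut.conjNormal g n)) ∈ irr N :=
      fun g => comp_equiv_irr (MulAut.conjNormal g) hθ
    obtain ⟨V, i1, i2, i3, ρ, hρ, rfl⟩ := hχ
    obtain ⟨W, j1, j2, j3, σ, hσ, rfl⟩ := hθ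
    obtain ⟨W', k1, k2, k3, σ', hσ', rfl⟩ := hθ'
    let ρN : Representation ℂ N V := ρ.comp N.subtype
    have hr : res N ρ.character = ρN.character := rfl
    rw [hr, exists_intertwine] at h
    rw [hr, ip_comm, exists_intertwine] at h'
    obtain ⟨f, hf, hfn⟩ := h
    obtain ⟨f', hf', hfn'⟩ := h'
    have hex : ∃ g : G, f' ∘ₗ ρ g ∘ₗ f ≠ 0 := by
      by_contra! hc
      let U : Subrepresentation ρ :=
        { toSubmodule := ⨅ g : G, LinearMap.ker (f' ∘ₗ ρ g)
          apply_mem_toSubmodule := by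
            intro g v hv
            simp only [Submodule.mem_iInf, LinearMap.mem_ker, LinearMap.comp_apply] at hv ⊢
            intro x
            have := hv (x * g)
            rwa [map_mul] at this }
      have hU : ∀ w, f w ∈ U := by
        intro w
        change f w ∈ (⨅ g : G, LinearMap.ker (f' ∘ₗ ρ g) : Submodule ℂ V)
        simp only [Submodule.mem_iInf]
        intro g
        exact LinearMap.congr_fun (hc g) w
      rcases hρ.eq_bot_or_eq_top U with hb | ht
      · apply hf
        ext w
        have := hU w
        rw [hb] at this
        exact this
      · apply hf'
        ext v
        have h1 : v ∈ U := by rw [ht]; trivial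
        have h2 : v ∈ (⨅ g : G, LinearMap.ker (f' ∘ₗ ρ g) : Submodule ℂ V) := h1
        simp only [Submodule.mem_iInf] at h2
        simpa using h2 1
    obtain ⟨g, hg⟩ := hex
    refine ⟨g⁻¹, ?_⟩
    let σg : Representation ℂ N W := σ.comp (MulAut.conjNormal (H := N) g⁻¹).toMonoidHom
    have h1 : ip σ'.character σg.character ≠ 0 := by
      rw [exists_intertwine]
      refine ⟨_, hg, fun n w => ?_⟩
      simp only [LinearMap.comp_apply]
      have e1 : f (σg n w) = ρ (g⁻¹ * n * g) (f w) := by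
        have := hfn (MulAut.conjNormal (H := N) g⁻¹ n) w
        simp only [ρN, MonoidHom.comp_apply, Subgroup.coe_subtype, MulAut.conjNormal_apply,
          inv_inv] at this
        exact this
      rw [e1, ← hfn']
      simp only [ρN, MonoidHom.comp_apply, Subgroup.coe_subtype]
      rw [← Module.End.mul_apply, ← Module.End.mul_apply, ← map_mul, ← map_mul]
      congr 3
      group
    have h2 : σg.character ∈ irr N := hc g⁻¹
    rw [ip_irr ⟨W', k1, k2, k3, σ', hσ', rfl⟩ h2] at h1
    simp only [ne_eq, ite_eq_right_iff, one_ne_zero, imp_false, not_not] at h1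
    exact h1.symm
  obtain ⟨g, rfl⟩ := key
  refine ⟨?_, by simp⟩
  obtain ⟨V, i1, i2, i3, ρ, hρ, rfl⟩ := hχ
  unfold ip
  congr 1
  symm
  apply Fintype.sum_equiv (MulAut.conjNormal (H := N) g).toEquiv
  intro n
  simp [res]

section twist

variable {p : ℕ} (hp : p.Prime) (l : G →* ℂ) (hl : ∀ g, l g ^ p = 1) (hlN : ∀ g, l g = 1 ↔ g ∈ N)

def tw (l : G →* ℂ) (i : ℕ) (χ : G → ℂ) : G → ℂ := fun g => l g ^ i * χ g

lemma tw_irr (i : ℕ) {χ : G → ℂ} (h : χ ∈ irr G) : tw l i χ ∈ irr G := by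
  have h1 := ip_irr_self h
  apply chr_norm_one
  · obtain ⟨V, i1, i2, i3, ρ, hρ, rfl⟩ := h
    let σ : Representation ℂ G V :=
      { toFun := fun g => (l g ^ i) • ρ g
        map_one' := by simp
        map_mul' := fun a b => by
          ext v
          simp [mul_pow, smul_smul, mul_comm] }
    refine ⟨V, i1, i2, i3, σ, ?_⟩
    ext g
    simp [σ, Representation.character, tw]
  · rw [← h1]
    unfold ip tw
    congr 1
    apply Finset.sum_congr rfl
    intro g _
    have : l g ^ i * l g⁻¹ ^ i = 1 := by
      rw [← mul_pow, ← map_mul]; simp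
    linear_combination (χ g * χ g⁻¹) * this

def van (N : Subgroup G) (χ : G → ℂ) : Prop := ∀ g, g ∉ N → χ g = 0

lemma van_tw (l : G →* ℂ) (hlN : ∀ g, l g = 1 ↔ g ∈ N) {χ : G → ℂ} (h : van N χ) (i : ℕ) : tw l i χ = χ := by
  ext g
  unfold tw
  by_cases hg : g ∈ N
  · rw [(hlN g).2 hg]; simp
  · rw [h g hg]; simp

include hp hl hlN

lemma pow_ne {g : G} (hg : g ∉ N) {i j : ℕ} (hi : i < p) (hj : j < p) (h : l g ^ i = l g ^ j) :
    i = j := by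
  have : Fact p.Prime := ⟨hp⟩
  have ho : orderOf (l g) = p := orderOf_eq_prime (hl g) (fun h => hg ((hlN g).1 h))
  rw [← ho] at hi hj
  exact pow_injOn_Iio_orderOf hi hj h

lemma avg (hidx : N.index = p) (χ ψ : G → ℂ) :
    ∑ i ∈ Finset.range p, ip χ (tw l i ψ) = ip (res N χ) (res N ψ) := by
  classical
  have hsum : ∀ g : G, ∑ i ∈ Finset.range p, l g ^ i = if g ∈ N then (p : ℂ) else 0 := by
    intro g
    split_ifs with hg
    · rw [(hlN g).2 hg]; simp
    · rw [geom_sum_eq (fun h => hg ((hlN g).1 h)), hl g]; simp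
  unfold ip tw
  rw [← Finset.mul_sum, Finset.sum_comm]
  have h1 : ∀ g : G, ∑ i ∈ Finset.range p, χ g * (l g⁻¹ ^ i * ψ g⁻¹) =
      if g ∈ N then (p : ℂ) * (χ g * ψ g⁻¹) else 0 := by
    intro g
    have h2 := hsum g⁻¹
    simp only [inv_mem_iff] at h2
    rw [← Finset.mul_sum, ← Finset.sum_mul, h2]
    split_ifs
    · ring
    · ring
  rw [Finset.sum_congr rfl (fun g _ => h1 g), ← Finset.sum_filter, ← Finset.mul_sum]
  have h3 : ∑ g with g ∈ N, χ g * ψ g⁻¹ = ∑ n : N, res N χ n * res N ψ n⁻¹ := by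
    rw [Finset.sum_subtype (p := (· ∈ N)) _ (by simp)]
    rfl
  rw [h3, ← N.card_mul_index, hidx]
  have := hp.ne_zero
  have h4 : (Nat.card N : ℂ) ≠ 0 := by simp
  push_cast
  field_simp

lemma not_van_tw {χ : G → ℂ} (h : ¬ van N χ) {i j : ℕ} (hi : i < p) (hj : j < p)
    (he : tw l i χ = tw l j χ) : i = j := by
  unfold van at h
  push Not at h
  obtain ⟨g, hg, h0⟩ := h
  exact pow_ne hp l hl hlN hg hi hj (mul_right_cancel₀ h0 (congrFun he g))

lemma not_van_irr (hidx : N.index = p) {χ : G → ℂ} (hχ : χ ∈ irr G) (h : ¬ van N χ) :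
    res N χ ∈ irr N := by
  classical
  apply chr_norm_one (res_chr (irr_chr hχ))
  rw [← avg hp l hl hlN hidx, Finset.sum_eq_single 0]
  · have : tw l 0 χ = χ := by ext; simp [tw]
    rw [this, ip_irr_self hχ]
  · intro i hi hi0
    rw [ip_irr hχ (tw_irr l i hχ), if_neg]
    intro he
    have : tw l 0 χ = χ := by ext; simp [tw]
    exact hi0 (not_van_tw hp l hl hlN h (Finset.mem_range.1 hi) hp.pos (this.trans he).symm)
  · intro h0
    exact absurd (Finset.mem_range.2 hp.pos) h0

lemma van_norm (hidx : N.index = p) {χ : G → ℂ} (hχ : χ ∈ irr G) (h : van N χ) :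
    ip (res N χ) (res N χ) = p := by
  rw [← avg hp l hl hlN hidx]
  simp [van_tw l hlN h, ip_irr_self hχ]

lemma shared (hidx : N.index = p) {χ ψ : G → ℂ} (hχ : χ ∈ irr G) (hψ : ψ ∈ irr G)
    (h : ip (res N χ) (res N ψ) ≠ 0) : ∃ i < p, χ = tw l i ψ := by
  classical
  rw [← avg hp l hl hlN hidx] at h
  obtain ⟨i, hi, h0⟩ := Finset.exists_ne_zero_of_sum_ne_zero h
  refine ⟨i, Finset.mem_range.1 hi, ?_⟩
  rw [ip_irr hχ (tw_irr l i hψ)] at h0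
  simpa using h0

open Classical in
noncomputable def cons (N : Subgroup G) [Fintype N] (χ : G → ℂ) : Finset (N → ℂ) :=
  (irrF N).filter fun θ => ip (res N χ) θ ≠ 0

lemma van_cons (hN : N.Normal) (hidx : N.index = p) {χ : G → ℂ} (hχ : χ ∈ irr G) (h : van N χ) :
    (cons N χ).card = p ∧ ∀ θ ∈ cons N χ, (p : ℂ) * θ 1 = χ 1 := by
  classical
  have hc := res_chr (N := N) (irr_chr hχ)
  have h1 := van_norm hp l hl hlN hidx hχ h
  rw [ip_expand hc] at h1
  have h2 : ∑ θ ∈ cons N χ, ip (res N χ) θ * ip (res N χ) θ = p := by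
    rw [← h1, cons, Finset.sum_filter]
    apply Finset.sum_congr rfl
    intro θ _
    split_ifs with h
    · rfl
    · simp only [ne_eq, not_not] at h; rw [h]; simp
  have hne : (cons N χ).Nonempty := by
    by_contra hcon
    rw [Finset.not_nonempty_iff_eq_empty] at hcon
    rw [hcon] at h2
    simp at h2
    exact hp.ne_zero (by exact_mod_cast h2.symm)
  obtain ⟨θ₀, hθ₀⟩ := hne
  have hm : ∀ θ ∈ cons N χ, θ ∈ irr N ∧ ip (res N χ) θ ≠ 0 := by
    intro θ hθ
    rw [cons, Finset.mem_filter, mem_irrF] at hθ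
    exact hθ
  have hall : ∀ θ ∈ cons N χ, ip (res N χ) θ = ip (res N χ) θ₀ ∧ θ 1 = θ₀ 1 := fun θ hθ =>
    clifford hN hχ (hm θ hθ).1 (hm θ₀ hθ₀).1 (hm θ hθ).2 (hm θ₀ hθ₀).2
  obtain ⟨a, ha⟩ := chr_nat hc (irr_chr (hm θ₀ hθ₀).1)
  rw [Finset.sum_congr rfl (fun θ hθ => by rw [(hall θ hθ).1, ha])] at h2
  have h3 : (cons N χ).card * (a * a) = p := by
    simp at h2
    exact_mod_cast h2
  have ha1 : a = 1 := by
    by_contra hne1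
    have hd : a ∣ p := ⟨(cons N χ).card * a, by rw [← h3]; ring⟩
    have hap : a = p := (Nat.dvd_prime hp).1 hd |>.resolve_left hne1
    rw [hap] at h3
    have hcp : (cons N χ).card * p = 1 := by
      apply Nat.eq_of_mul_eq_mul_right hp.pos
      linarith
    have := Nat.eq_one_of_mul_eq_one_left hcp
    exact hp.one_lt.ne' this
  have hcard : (cons N χ).card = p := by rw [← h3, ha1]; simp
  refine ⟨hcard, fun θ hθ => ?_⟩
  have h4 := congrFun (chr_expand hc) 1
  have h5 : res N χ 1 = χ 1 := rfl
  rw [← h5, h4]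
  have h6 : (∑ θ ∈ irrF N, ip (res N χ) θ • θ) 1 = ∑ θ ∈ cons N χ, ip (res N χ) θ * θ 1 := by
    rw [cons, Finset.sum_filter]
    simp only [Finset.sum_apply, Pi.smul_apply, smul_eq_mul]
    apply Finset.sum_congr rfl
    intro θ _
    split_ifs with h
    · rfl
    · simp only [ne_eq, not_not] at h; rw [h]; simp
  rw [h6, Finset.sum_congr rfl (fun η hη => by rw [(hall η hη).1, (hall η hη).2, ha, ha1]),
    (hall θ hθ).2]
  simp [hcard]

end twist
end clifford
section counting

lemma exists_lin {G : Type} [Group G] [Finite G] {p : ℕ} (hp : p.Prime) (N : Subgroup G)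
    (hN : N.Normal) (hidx : N.index = p) :
    ∃ l : G →* ℂ, (∀ g, l g ^ p = 1) ∧ ∀ g, l g = 1 ↔ g ∈ N := by
  have : Fact p.Prime := ⟨hp⟩
  have hcard : Nat.card (G ⧸ N) = p := hidx
  have hcyc : IsCyclic (G ⧸ N) := isCyclic_of_prime_card hcard
  let _ : CommGroup (G ⧸ N) := IsCyclic.commGroup
  have hnt : Nontrivial (G ⧸ N) := by
    rw [← Finite.one_lt_card_iff_nontrivial, hcard]; exact hp.one_lt
  obtain ⟨a, ha⟩ := exists_ne (1 : G ⧸ N)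
  have : NeZero (Monoid.exponent (G ⧸ N)) := ⟨Monoid.exponent_ne_zero_of_finite⟩
  obtain ⟨φ, hφ⟩ := CommGroup.exists_apply_ne_one_of_hasEnoughRootsOfUnity (G ⧸ N) ℂ ha
  have hker : φ.ker = ⊥ := by
    have hs : IsSimpleGroup (G ⧸ N) := isSimpleGroup_of_prime_card hcard
    rcases (inferInstance : φ.ker.Normal).eq_bot_or_eq_top with h | h
    · exact h
    · exfalso
      apply hφ
      have : a ∈ φ.ker := by rw [h]; trivial
      exact this
  refine ⟨(Units.coeHom ℂ).comp (φ.comp (QuotientGroup.mk' N)), fun g => ?_, fun g => ?_⟩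
  · rw [← map_pow, MonoidHom.comp_apply, MonoidHom.comp_apply]
    have : (QuotientGroup.mk' N) (g ^ p) = 1 := by
      rw [map_pow, ← hcard, pow_card_eq_one']
    rw [this]; simp
  · rw [MonoidHom.comp_apply, MonoidHom.comp_apply]
    simp only [Units.coeHom_apply, Units.val_eq_one]
    rw [← MonoidHom.mem_ker, hker, Subgroup.mem_bot]
    exact QuotientGroup.eq_one_iff g

variable {G : Type} [Group G] [Fintype G]

open Classical in
noncomputable def irrDF (G : Type) [Group G] [Fintype G] (d : ℕ) : Finset (G → ℂ) :=
  (irrF G).filter fun χ => χ 1 = d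

lemma mem_irrDF {d : ℕ} {χ : G → ℂ} : χ ∈ irrDF G d ↔ χ ∈ irr G ∧ χ 1 = d := by
  simp [irrDF, mem_irrF]

lemma irrDF_card (d : ℕ) : (irrDF G d).card = (irrD G d).ncard := by
  rw [← Set.ncard_coe_finset]
  congr 1
  ext χ
  simp [mem_irrDF, irrD]

lemma irrDF_le (d : ℕ) : (irrDF G d).card ≤ maxMult G := by
  rw [irrDF_card]; exact mult_le d

lemma mem_cons {N : Subgroup G} [Fintype N] {χ : G → ℂ} {θ : N → ℂ} :
    θ ∈ cons N χ ↔ θ ∈ irr N ∧ ip (res N χ) θ ≠ 0 := by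
  rw [cons, Finset.mem_filter, mem_irrF]

lemma step {p : ℕ} (hp : p.Prime) (N : Subgroup G) [Fintype N]
    (hN : N.Normal) (hidx : N.index = p) :
    p * maxMult G ≤ (p ^ 2 + 1) * maxMult N ∧ p * maxMult N ≤ (p ^ 2 + 1) * maxMult G := by
  classical
  obtain ⟨l, hl, hlN⟩ := exists_lin hp N hN hidx
  have hnv := fun {χ : G → ℂ} => not_van_irr (χ := χ) hp l hl hlN hidx
  have hvc := fun {χ : G → ℂ} => van_cons (χ := χ) hp l hl hlN hN hidx
  have hsh := fun {χ ψ : G → ℂ} => shared (χ := χ) (ψ := ψ) hp l hl hlN hidx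
  have hp0 : (p : ℂ) ≠ 0 := by exact_mod_cast hp.ne_zero
  -- restriction of twists
  have hrt : ∀ i χ, res N (tw l i χ) = res N χ := by
    intro i χ
    ext n
    simp [res, tw, (hlN n).2 n.2]
  have hvt : ∀ i χ, van N (tw l i χ) → van N χ := by
    intro i χ h g hg
    have h1 := h g hg
    have h2 : l g ≠ 0 := by
      intro h0
      have := hl g
      rw [h0, zero_pow hp.ne_zero] at this
      exact zero_ne_one this
    simpa [tw, h2] using h1
  let A := fun d => (irrDF G d).filter fun χ => ¬ van N χ
  let B := fun d => (irrDF G d).filter fun χ => van N χ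
  -- case A, fibers
  have hA1 : ∀ d, (A d).card ≤ p * ((A d).image (res N)).card := by
    intro d
    apply Finset.card_le_mul_card_image
    intro θ hθ
    obtain ⟨χ, hχ, rfl⟩ := Finset.mem_image.1 hθ
    obtain ⟨hχd, hχv⟩ := Finset.mem_filter.1 hχ
    have hχi := (mem_irrDF.1 hχd).1
    have hsub : (A d).filter (fun ψ => res N ψ = res N χ) ⊆
        (Finset.range p).image (fun i => tw l i χ) := by
      intro ψ hψ
      obtain ⟨hψA, hr⟩ := Finset.mem_filter.1 hψ
      have hψi := (mem_irrDF.1 (Finset.mem_filter.1 hψA).1).1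
      obtain ⟨i, hi, rfl⟩ := hsh hψi hχi (by
        rw [hr, ip_irr_self (hnv hχi hχv)]; exact one_ne_zero)
      exact Finset.mem_image.2 ⟨i, Finset.mem_range.2 hi, rfl⟩
    exact (Finset.card_le_card hsub).trans (Finset.card_image_le.trans (by simp))
  have hA2 : ∀ d, p * ((A d).image (res N)).card ≤ (A d).card := by
    intro d
    apply Finset.mul_card_image_le_card
    intro θ hθ
    obtain ⟨χ, hχ, rfl⟩ := Finset.mem_image.1 hθ
    obtain ⟨hχd, hχv⟩ := Finset.mem_filter.1 hχ
    obtain ⟨hχi, hχ1⟩ := mem_irrDF.1 hχd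
    have hsub : (Finset.range p).image (fun i => tw l i χ) ⊆
        (A d).filter (fun ψ => res N ψ = res N χ) := by
      intro ψ hψ
      obtain ⟨i, hi, rfl⟩ := Finset.mem_image.1 hψ
      refine Finset.mem_filter.2 ⟨Finset.mem_filter.2
        ⟨mem_irrDF.2 ⟨tw_irr l i hχi, ?_⟩, fun h => hχv (hvt _ _ h)⟩, hrt i χ⟩
      simp [tw, hχ1]
    refine le_trans ?_ (Finset.card_le_card hsub)
    rw [Finset.card_image_of_injOn, Finset.card_range]
    intro i hi j hj h
    simp only [Finset.coe_range, Set.mem_Iio] at hi hj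
    exact not_van_tw hp l hl hlN hχv hi hj h
  have hA3 : ∀ d, ((A d).image (res N)) ⊆ irrDF N d := by
    intro d θ hθ
    obtain ⟨χ, hχ, rfl⟩ := Finset.mem_image.1 hθ
    obtain ⟨hχd, hχv⟩ := Finset.mem_filter.1 hχ
    obtain ⟨hχi, hχ1⟩ := mem_irrDF.1 hχd
    exact mem_irrDF.2 ⟨hnv hχi hχv, hχ1⟩
  have hB1 : ∀ d, p * (B d).card ≤ (irrDF N (d / p)).card := by
    intro d
    have hdis : ((B d : Finset (G → ℂ)) : Set (G → ℂ)).PairwiseDisjoint (cons N) := by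
      intro χ hχ ψ hψ hne
      obtain ⟨hχd, hχv⟩ := Finset.mem_filter.1 hχ
      obtain ⟨hχi, hχ1⟩ := mem_irrDF.1 hχd
      obtain ⟨hψd, hψv⟩ := Finset.mem_filter.1 hψ
      obtain ⟨hψi, hψ1⟩ := mem_irrDF.1 hψd
      change Disjoint (cons N χ) (cons N ψ)
      rw [Finset.disjoint_left]
      intro θ h1 h2
      apply hne
      have hip : ip (res N χ) (res N ψ) ≠ 0 := by
        have hc1 := res_chr (N := N) (irr_chr hχi)
        have hc2 := res_chr (N := N) (irr_chr hψi)
        rw [ip_expand hc1]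
        have e1 : ∀ η ∈ irrF N, ∃ n : ℕ, ip (res N χ) η = n := fun η hη =>
          chr_nat hc1 (irr_chr (mem_irrF.1 hη))
        have e2 : ∀ η ∈ irrF N, ∃ n : ℕ, ip (res N ψ) η = n := fun η hη =>
          chr_nat hc2 (irr_chr (mem_irrF.1 hη))
        choose! a ha using e1
        choose! b hb using e2
        rw [Finset.sum_congr rfl (fun η hη => by rw [ha η hη, hb η hη])]
        have hθ := mem_irrF.2 (mem_cons.1 h1).1
        have h3 := (mem_cons.1 h1).2
        have h4 := (mem_cons.1 h2).2
        rw [ha θ hθ] at h3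
        rw [hb θ hθ] at h4
        have h5 : ∑ η ∈ irrF N, a η * b η ≠ 0 := by
          intro h6
          exact (Finset.sum_eq_zero_iff.1 h6 θ hθ) |> (mul_ne_zero (by exact_mod_cast h3) (by exact_mod_cast h4))
        exact_mod_cast h5
      obtain ⟨i, hi, h⟩ := hsh hχi hψi hip
      rw [h, van_tw l hlN hψv]
    have h1 : ((B d).biUnion (cons N)).card = p * (B d).card := by
      rw [Finset.card_biUnion hdis, Finset.sum_congr rfl (g := fun _ => p), Finset.sum_const,
        smul_eq_mul, mul_comm]
      intro χ hχ
      obtain ⟨hχd, hχv⟩ := Finset.mem_filter.1 hχ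
      exact (hvc (mem_irrDF.1 hχd).1 hχv).1
    rw [← h1]
    apply Finset.card_le_card
    intro θ hθ
    obtain ⟨χ, hχ, hθ⟩ := Finset.mem_biUnion.1 hθ
    obtain ⟨hχd, hχv⟩ := Finset.mem_filter.1 hχ
    obtain ⟨hχi, hχ1⟩ := mem_irrDF.1 hχd
    have h2 := (hvc hχi hχv).2 θ hθ
    have hθi := (mem_cons.1 hθ).1
    refine mem_irrDF.2 ⟨hθi, ?_⟩
    obtain ⟨e, he⟩ := chr_deg (irr_chr hθi)
    rw [he, hχ1] at h2
    have h3 : p * e = d := by exact_mod_cast h2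
    rw [he, ← h3, Nat.mul_div_cancel_left _ hp.pos]
  have hcov : ∀ d, irrDF N d ⊆ (A d).image (res N) ∪ (B (p * d)).biUnion (cons N) := by
    intro d θ hθ
    obtain ⟨hθi, hθ1⟩ := mem_irrDF.1 hθ
    obtain ⟨χ, hχi, hip⟩ := exists_over hθi
    change ip (res N χ) θ ≠ 0 at hip
    by_cases hv : van N χ
    · apply Finset.mem_union_right
      have hθc := mem_cons.2 ⟨hθi, hip⟩
      refine Finset.mem_biUnion.2 ⟨χ, Finset.mem_filter.2 ⟨mem_irrDF.2 ⟨hχi, ?_⟩, hv⟩, hθc⟩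
      rw [← (hvc hχi hv).2 θ hθc, hθ1]
      push_cast
      rfl
    · apply Finset.mem_union_left
      have hri := hnv hχi hv
      have he : res N χ = θ := by
        by_contra hne
        rw [ip_irr hri hθi, if_neg hne] at hip
        exact hip rfl
      refine Finset.mem_image.2 ⟨χ, Finset.mem_filter.2 ⟨mem_irrDF.2 ⟨hχi, ?_⟩, hv⟩, he⟩
      rw [← hθ1, ← he]
      rfl
  have hB2 : ∀ d, ((B d).biUnion (cons N)).card ≤ (B d).card * p := by
    intro d
    apply Finset.card_biUnion_le_card_mul
    intro χ hχ
    obtain ⟨hχd, hχv⟩ := Finset.mem_filter.1 hχ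
    exact (hvc (mem_irrDF.1 hχd).1 hχv).1.le
  constructor
  · apply maxMult_le
    intro d
    rw [← irrDF_card]
    have h0 : (B d).card + (A d).card = (irrDF G d).card :=
      Finset.card_filter_add_card_filter_not _
    have h1 := hA1 d
    have h2 := (Finset.card_le_card (hA3 d)).trans (irrDF_le d)
    have h3 := (hB1 d).trans (irrDF_le _)
    rw [← h0]
    calc p * ((B d).card + (A d).card) = p * (B d).card + p * (A d).card := by ring
      _ ≤ maxMult N + p * (p * maxMult N) :=
        Nat.add_le_add h3 (Nat.mul_le_mul_left _ (h1.trans (Nat.mul_le_mul_left _ h2)))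
      _ = _ := by ring
  · apply maxMult_le
    intro d
    rw [← irrDF_card]
    have h0 := (Finset.card_le_card (hcov d)).trans (Finset.card_union_le _ _)
    have h1 := (hA2 d).trans ((Finset.card_le_card (Finset.filter_subset _ _)).trans (irrDF_le d))
    have h2 : (B (p * d)).card ≤ maxMult G :=
      (Finset.card_le_card (Finset.filter_subset _ _)).trans (irrDF_le _)
    have h3 := hB2 (p * d)
    calc p * (irrDF N d).card ≤ p * (((A d).image (res N)).card +
          ((B (p * d)).biUnion (cons N)).card) := Nat.mul_le_mul_left _ h0
      _ = p * ((A d).image (res N)).card + p * ((B (p * d)).biUnion (cons N)).card := by ring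
      _ ≤ maxMult G + p * (maxMult G * p) :=
        Nat.add_le_add h1 (Nat.mul_le_mul_left _ (h3.trans (Nat.mul_le_mul_right _ h2)))
      _ = _ := by ring

end counting

theorem main_aux (p : ℕ) (hp : p.Prime) (n : ℕ) : ∀ (G : Type) [Group G] [Finite G]
    (_ : IsPGroup p G) (N : Subgroup G) (_ : N.Normal) (_ : N.index = p ^ n),
    p ^ n * maxMult G ≤ (p ^ 2 + 1) ^ n * maxMult N ∧
    p ^ n * maxMult N ≤ (p ^ 2 + 1) ^ n * maxMult G := by
  induction n with
  | zero =>
    intro G _ _ hG N hN hidx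
    have : Fintype G := Fintype.ofFinite G
    have : Fintype N := Fintype.ofFinite N
    rw [pow_zero, Subgroup.index_eq_one] at hidx
    have e : N ≃* G := (MulEquiv.subgroupCongr hidx).trans Subgroup.topEquiv
    rw [maxMult_equiv e]
    simp
  | succ n ih =>
    intro G _ _ hG N hN hidx
    have : Fact p.Prime := ⟨hp⟩
    have hcardQ : Nat.card (G ⧸ N) = p ^ (n + 1) := hidx
    obtain ⟨K, hK⟩ := Sylow.exists_subgroup_card_pow_prime (G := G ⧸ N) p (n := n)
      (by rw [hcardQ]; exact pow_dvd_pow p (Nat.le_succ n))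
    have hKi : K.index = p := by
      have := K.card_mul_index
      rw [hK, hcardQ, pow_succ] at this
      exact Nat.eq_of_mul_eq_mul_left (pow_pos hp.pos n) this
    let M := K.comap (QuotientGroup.mk' N)
    have hMi : M.index = p := by
      rw [Subgroup.index_comap_of_surjective _ (QuotientGroup.mk'_surjective N), hKi]
    have hM : M.Normal := by
      apply Subgroup.normal_of_index_eq_minFac_card
      obtain ⟨k, hk⟩ := IsPGroup.iff_card.1 hG
      have hk0 : k ≠ 0 := by
        rintro rfl
        rw [pow_zero] at hk
        have h1 := M.index_dvd_card
        rw [hk, hMi, Nat.dvd_one] at h1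
        exact hp.one_lt.ne' h1
      rw [hMi, hk, hp.pow_minFac hk0]
    have hNM : N ≤ M := by
      intro x hx
      change QuotientGroup.mk' N x ∈ K
      have : QuotientGroup.mk' N x = 1 := (QuotientGroup.eq_one_iff x).2 hx
      rw [this]; exact K.one_mem
    have hrel : (N.subgroupOf M).index = p ^ n := by
      have h1 : N.relIndex M * M.index = N.index := Subgroup.relIndex_mul_index hNM
      rw [hMi, hidx, pow_succ] at h1
      exact Nat.eq_of_mul_eq_mul_right hp.pos h1
    have h1 := ih M (hG.to_subgroup M) (N.subgroupOf M) inferInstance hrel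
    have : Fintype G := Fintype.ofFinite G
    have : Fintype N := Fintype.ofFinite N
    have : Fintype M := Fintype.ofFinite M
    have : Fintype (N.subgroupOf M) := Fintype.ofFinite _
    rw [← maxMult_equiv (Subgroup.subgroupOfEquivOfLe hNM)] at h1
    have h2 := step hp M hM hMi
    obtain ⟨a1, a2⟩ := h1
    obtain ⟨b1, b2⟩ := h2
    constructor
    · calc p ^ (n + 1) * maxMult G = p ^ n * (p * maxMult G) := by ring
        _ ≤ p ^ n * ((p ^ 2 + 1) * maxMult M) := Nat.mul_le_mul_left _ b1
        _ = (p ^ 2 + 1) * (p ^ n * maxMult M) := by ring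
        _ ≤ (p ^ 2 + 1) * ((p ^ 2 + 1) ^ n * maxMult N) := Nat.mul_le_mul_left _ a1
        _ = _ := by ring
    · calc p ^ (n + 1) * maxMult N = p * (p ^ n * maxMult N) := by ring
        _ ≤ p * ((p ^ 2 + 1) ^ n * maxMult M) := Nat.mul_le_mul_left _ a2
        _ = (p ^ 2 + 1) ^ n * (p * maxMult M) := by ring
        _ ≤ (p ^ 2 + 1) ^ n * ((p ^ 2 + 1) * maxMult G) := Nat.mul_le_mul_left _ b2
        _ = _ := by ring

theorem stmt10 (p : ℕ) (hp : p.Prime) (G : Type) [Group G] [Finite G]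
    (hG : IsPGroup p G) (N : Subgroup G) (hN : N.Normal) (n : ℕ)
    (hidx : N.index = p ^ n) :
    ((p : ℝ) / (p ^ 2 + 1)) ^ n * (maxMult G : ℝ) ≤ (maxMult N : ℝ) ∧
    (maxMult N : ℝ) ≤ (((p : ℝ) ^ 2 + 1) / p) ^ n * (maxMult G : ℝ) := by
  obtain ⟨h1, h2⟩ := main_aux p hp n G hG N hN hidx
  have h1' : (p : ℝ) ^ n * maxMult G ≤ ((p : ℝ) ^ 2 + 1) ^ n * maxMult N := by exact_mod_cast h1
  have h2' : (p : ℝ) ^ n * maxMult N ≤ ((p : ℝ) ^ 2 + 1) ^ n * maxMult G := by exact_mod_cast h2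
  have hp0 : (0 : ℝ) < p := by exact_mod_cast hp.pos
  constructor
  · rw [div_pow, div_mul_eq_mul_div, div_le_iff₀ (by positivity)]
    linarith
  · rw [div_pow, div_mul_eq_mul_div, le_div_iff₀ (by positivity)]
    linarith
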